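/- Let L_X be an evaluation code on X and let ≺ be a monomial order on S. Then the evaluation code (L^⊥)_X of the algebraic dual is a standard monomial code on X (i.e. L^⊥ is spanned by monomials) if and only if the number of standard monomials lying in (ker φ : L), namely |(ker φ : L) ∩ Δ_≺(I)|, equals |X| − dim_K(L_X). -/

import Mathlib

open MvPolynomial

noncomputable section

variable {K : Type*} [Field K] {s m : ℕ}

/-- Evaluation linear map at a family of points. -/
def evalMap (P : Fin m → (Fin s → K)) :
    MvPolynomial (Fin s) K →ₗ[K] (Fin m → K) :=
  LinearMap.pi fun i => (MvPolynomial.aeval (P i)).toLinearMap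

/-- Vanishing ideal of a finite family of points. -/
def vanishingIdeal (P : Fin m → (Fin s → K)) : Ideal (MvPolynomial (Fin s) K) :=
  ⨅ i, RingHom.ker (MvPolynomial.eval (P i))

/-- The linear map `φ : f ↦ ∑ i, f(P i)`. -/
def sumEval (P : Fin m → (Fin s → K)) : MvPolynomial (Fin s) K →ₗ[K] K :=
  ∑ i, (MvPolynomial.aeval (P i)).toLinearMap

/-- The leading exponent (initial monomial exponent) of a polynomial w.r.t. a monomial order. -/
def leadExpo (mo : MonomialOrder (Fin s)) (f : MvPolynomial (Fin s) K) : Fin s →₀ ℕ :=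
  mo.toSyn.symm (f.support.sup fun a => mo.toSyn a)

/-- The initial ideal of `I` w.r.t. a monomial order. -/
def initialIdeal (mo : MonomialOrder (Fin s)) (I : Ideal (MvPolynomial (Fin s) K)) :
    Ideal (MvPolynomial (Fin s) K) :=
  Ideal.span ((fun f => (monomial (leadExpo mo f) (1 : K))) '' {f | f ∈ I ∧ f ≠ 0})

/-- The set of exponents of standard monomials of `S/I`. -/
def stdMon (mo : MonomialOrder (Fin s)) (I : Ideal (MvPolynomial (Fin s) K)) :
    Set (Fin s →₀ ℕ) :=
  {a | monomial a (1 : K) ∉ initialIdeal mo I}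

/-- `K Δ_≺(I)`, the span of the standard monomials. -/
def stdSpan (mo : MonomialOrder (Fin s)) (I : Ideal (MvPolynomial (Fin s) K)) :
    Submodule K (MvPolynomial (Fin s) K) :=
  Submodule.span K ((fun a => monomial a (1 : K)) '' stdMon mo I)

/-- The space `(ker φ : L) = {g | g·f ∈ ker φ for all f ∈ L}`. -/
def colonKer (φ : MvPolynomial (Fin s) K →ₗ[K] K)
    (L : Submodule K (MvPolynomial (Fin s) K)) : Submodule K (MvPolynomial (Fin s) K) where
  carrier := {g | ∀ f ∈ L, φ (g * f) = 0}
  add_mem' := fun ha hb f hf => by rw [add_mul, map_add, ha f hf, hb f hf, add_zero]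
  zero_mem' := fun f hf => by rw [zero_mul, map_zero]
  smul_mem' := fun c a ha f hf => by rw [smul_mul_assoc, map_smul, ha f hf, smul_zero]

/-- The algebraic dual `L^⊥ = (ker φ : L) ∩ KΔ_≺(I)`. -/
def algDual (P : Fin m → (Fin s → K)) (mo : MonomialOrder (Fin s))
    (L : Submodule K (MvPolynomial (Fin s) K)) : Submodule K (MvPolynomial (Fin s) K) :=
  colonKer (sumEval P) L ⊓ stdSpan mo (vanishingIdeal P)

/-- The dual of a linear code in `K^m`. -/
def dualCode (C : Submodule K (Fin m → K)) : Submodule K (Fin m → K) where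
  carrier := {α | ∀ β ∈ C, ∑ i, α i * β i = 0}
  add_mem' := fun ha hb β hβ => by
    simp only [Pi.add_apply, add_mul, Finset.sum_add_distrib]
    rw [ha β hβ, hb β hβ, add_zero]
  zero_mem' := fun β hβ => by simp
  smul_mem' := fun c a ha β hβ => by
    simp only [Pi.smul_apply, smul_eq_mul, mul_assoc, ← Finset.mul_sum]
    rw [ha β hβ, mul_zero]

/-- Coordinatewise scaling of `K^m` by a vector `β`. -/
def scaleMap (β : Fin m → K) : (Fin m → K) →ₗ[K] (Fin m → K) :=
  LinearMap.pi fun i => β i • LinearMap.proj i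

/-- A monomial order is graded if it refines total degree. -/
def MonomialOrder.IsGraded (mo : MonomialOrder (Fin s)) : Prop :=
  ∀ a b : Fin s →₀ ℕ, Finsupp.degree a < Finsupp.degree b → mo.toSyn a < mo.toSyn b

/-- The affine Hilbert function of the vanishing ideal of the points `P`. -/
def hilbA (P : Fin m → (Fin s → K)) (d : ℕ) : ℕ :=
  Module.finrank K
    (Submodule.map (Ideal.Quotient.mkₐ K (vanishingIdeal P)).toLinearMap
      (restrictTotalDegree (Fin s) K d))

/-- The affine Hilbert function, with `H(d) = 0` for `d < 0`. -/
def hilbAZ (P : Fin m → (Fin s → K)) (d : ℤ) : ℕ :=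
  if d < 0 then 0 else hilbA P d.toNat

/-- The Reed–Muller-type code of degree `d` on the points `P`. -/
def RMcode (P : Fin m → (Fin s → K)) (d : ℕ) : Submodule K (Fin m → K) :=
  Submodule.map (evalMap P) (restrictTotalDegree (Fin s) K d)

/-- The Reed–Muller-type code indexed by an integer degree, `⊥` for `d < 0`. -/
def RMcodeZ (P : Fin m → (Fin s → K)) (d : ℤ) : Submodule K (Fin m → K) :=
  if d < 0 then ⊥ else RMcode P d.toNat

/-- The vanishing ideal of a single point. -/
def pointIdeal (Q : Fin s → K) : Ideal (MvPolynomial (Fin s) K) :=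
  RingHom.ker (MvPolynomial.eval Q)

/-- The local v-number `v_𝔭(I)`. -/
def vNumAt (I 𝔭 : Ideal (MvPolynomial (Fin s) K)) : ℕ :=
  sInf {d | ∃ f : MvPolynomial (Fin s) K, f ≠ 0 ∧ f.totalDegree = d ∧
    I.colon (Ideal.span {f}) = 𝔭}

/-- `f` is an indicator function for the `i`-th point. -/
def IsIndicator (P : Fin m → (Fin s → K)) (f : MvPolynomial (Fin s) K) (i : Fin m) : Prop :=
  MvPolynomial.eval (P i) f ≠ 0 ∧ ∀ j, j ≠ i → MvPolynomial.eval (P j) f = 0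

/-- The minimum distance of a linear code. -/
def minDist (C : Submodule K (Fin m → K)) : ℕ :=
  sInf {w | ∃ v ∈ C, v ≠ 0 ∧ Set.ncard {i | v i ≠ 0} = w}

theorem evalMap_apply (P : Fin m → (Fin s → K)) (f : MvPolynomial (Fin s) K) (i : Fin m) :
    evalMap P f i = eval (P i) f := by
  simp [evalMap, aeval_eq_eval]

theorem sumEval_mul (P : Fin m → (Fin s → K)) (f g : MvPolynomial (Fin s) K) :
    sumEval P (f * g) = ∑ i, evalMap P f i * evalMap P g i := by
  simp [sumEval, evalMap_apply, aeval_eq_eval]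

theorem mem_vanishingIdeal_iff_evalMap_eq_zero (P : Fin m → (Fin s → K))
    (f : MvPolynomial (Fin s) K) : f ∈ _root_.vanishingIdeal P ↔ evalMap P f = 0 := by
  simp [_root_.vanishingIdeal, Submodule.mem_iInf, funext_iff, evalMap_apply, RingHom.mem_ker]

theorem evalMap_surjective [Finite K] {P : Fin m → (Fin s → K)} (hP : Function.Injective P) :
    Function.Surjective (evalMap P) := by
  intro v
  have := Fintype.ofFinite K
  have hv : Function.extend P v 0 ∈
      (restrictDegree (Fin s) K (Fintype.card K - 1)).map (evalₗ K (Fin s)) := by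
    rw [map_restrict_dom_evalₗ]
    trivial
  obtain ⟨f, -, hf⟩ := hv
  refine ⟨f, funext fun i => ?_⟩
  rw [evalMap_apply, ← hP.extend_apply v 0 i, ← hf, evalₗ_apply]

theorem stdSpan_eq_restrictSupport (mo : MonomialOrder (Fin s))
    (I : Ideal (MvPolynomial (Fin s) K)) : stdSpan mo I = restrictSupport K (stdMon mo I) :=
  (restrictSupport_eq_span K _).symm

theorem mem_stdMon_iff (mo : MonomialOrder (Fin s)) (I : Ideal (MvPolynomial (Fin s) K))
    (a : Fin s →₀ ℕ) : a ∈ stdMon mo I ↔ ∀ f ∈ I, f ≠ 0 → ¬ mo.degree f ≤ a := by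
  have h : initialIdeal mo I = Ideal.span
      ((fun b => monomial b (1 : K)) '' (mo.degree '' {f | f ∈ I ∧ f ≠ 0})) := by
    rw [Set.image_image]
    rfl
  change monomial a (1 : K) ∉ initialIdeal mo I ↔ _
  rw [h, mem_ideal_span_monomial_image]
  classical
  simp [support_monomial]

theorem disjoint_stdSpan (mo : MonomialOrder (Fin s)) (I : Ideal (MvPolynomial (Fin s) K))
    {f : MvPolynomial (Fin s) K} (hf : f ∈ stdSpan mo I) (hfI : f ∈ I) : f = 0 := by
  by_contra h0
  rw [stdSpan_eq_restrictSupport, mem_restrictSupport_iff] at hf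
  exact (mem_stdMon_iff mo I _).1 (hf (mo.degree_mem_support h0)) f hfI h0 le_rfl

theorem exists_mem_stdSpan_sub_mem (mo : MonomialOrder (Fin s))
    (I : Ideal (MvPolynomial (Fin s) K)) (f : MvPolynomial (Fin s) K) :
    ∃ r ∈ stdSpan mo I, f - r ∈ I := by
  obtain ⟨g, r, hf, -, hr⟩ := mo.div_set (B := {f | f ∈ I ∧ f ≠ 0})
    (fun b hb => (mo.leadingCoeff_ne_zero_iff.2 hb.2).isUnit) f
  refine ⟨r, ?_, ?_⟩
  · rw [stdSpan_eq_restrictSupport, mem_restrictSupport_iff]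
    exact fun c hc => (mem_stdMon_iff mo I c).2 fun b hb h0 => hr c hc b ⟨hb, h0⟩
  · rw [hf, add_sub_cancel_right, Finsupp.linearCombination_apply]
    exact I.sum_mem fun b _ => I.mul_mem_left _ b.2.1

/-- Evaluation identifies `K Δ_≺(I)` with `K^m`. -/
def stdSpanEquiv [Finite K] {P : Fin m → (Fin s → K)} (hP : Function.Injective P)
    (mo : MonomialOrder (Fin s)) : stdSpan mo (_root_.vanishingIdeal P) ≃ₗ[K] (Fin m → K) :=
  LinearEquiv.ofBijective ((evalMap P).domRestrict (stdSpan mo (_root_.vanishingIdeal P))) <| by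
    constructor
    · rw [← LinearMap.ker_eq_bot, LinearMap.ker_eq_bot']
      exact fun f hf => Subtype.ext <| disjoint_stdSpan mo _ f.2 <|
        (mem_vanishingIdeal_iff_evalMap_eq_zero P _).2 hf
    · intro v
      obtain ⟨f, rfl⟩ := evalMap_surjective hP v
      obtain ⟨r, hr, hfr⟩ := exists_mem_stdSpan_sub_mem mo (_root_.vanishingIdeal P) f
      rw [mem_vanishingIdeal_iff_evalMap_eq_zero, map_sub, sub_eq_zero] at hfr
      exact ⟨⟨r, hr⟩, hfr.symm⟩

theorem mem_colonKer_sumEval_iff (P : Fin m → (Fin s → K))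
    (L : Submodule K (MvPolynomial (Fin s) K)) (g : MvPolynomial (Fin s) K) :
    g ∈ colonKer (sumEval P) L ↔ evalMap P g ∈ dualCode (L.map (evalMap P)) := by
  change (∀ f ∈ L, sumEval P (g * f) = 0) ↔
    ∀ β ∈ L.map (evalMap P), ∑ i, evalMap P g i * β i = 0
  simp [sumEval_mul]

theorem finrank_dualCode (C : Submodule K (Fin m → K)) :
    Module.finrank K (dualCode C) = m - Module.finrank K C := by
  have h : dualCode C = C.dualAnnihilator.comap (dotProductEquiv K (Fin m)).toLinearMap := by
    ext α
    change (∀ β ∈ C, ∑ i, α i * β i = 0) ↔ _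
    simp [Submodule.mem_dualAnnihilator, dotProduct]
  have h' := Subspace.finrank_add_finrank_dualAnnihilator_eq C
  rw [Module.finrank_fin_fun] at h'
  rw [h, Submodule.comap_equiv_eq_map_symm, LinearEquiv.finrank_map_eq]
  omega

theorem algDual_eq_map_subtype [Finite K] {P : Fin m → (Fin s → K)}
    (hP : Function.Injective P) (mo : MonomialOrder (Fin s))
    (L : Submodule K (MvPolynomial (Fin s) K)) :
    algDual P mo L = ((dualCode (L.map (evalMap P))).comap
      (stdSpanEquiv hP mo).toLinearMap).map (Submodule.subtype _) := by
  ext g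
  rw [algDual, Submodule.mem_inf, mem_colonKer_sumEval_iff]
  constructor
  · exact fun ⟨hg, hg'⟩ => ⟨⟨g, hg'⟩, hg, rfl⟩
  · rintro ⟨⟨g, hg'⟩, hg, rfl⟩
    exact ⟨hg, hg'⟩

theorem finrank_algDual [Finite K] {P : Fin m → (Fin s → K)} (hP : Function.Injective P)
    (mo : MonomialOrder (Fin s)) (L : Submodule K (MvPolynomial (Fin s) K)) :
    Module.finrank K (algDual P mo L) = m - Module.finrank K (L.map (evalMap P)) := by
  rw [algDual_eq_map_subtype hP, Submodule.finrank_map_subtype_eq,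
    Submodule.comap_equiv_eq_map_symm, LinearEquiv.finrank_map_eq, finrank_dualCode]

theorem finite_algDual [Finite K] {P : Fin m → (Fin s → K)} (hP : Function.Injective P)
    (mo : MonomialOrder (Fin s)) (L : Submodule K (MvPolynomial (Fin s) K)) :
    Module.Finite K (algDual P mo L) := by
  have := Module.Finite.equiv (stdSpanEquiv hP mo).symm
  rw [algDual_eq_map_subtype hP]
  infer_instance

theorem finrank_restrictSupport (Γ : Set (Fin s →₀ ℕ)) :
    Module.finrank K (restrictSupport K Γ) = Γ.ncard :=
  Module.finrank_eq_nat_card_basis (basisRestrictSupport K Γ)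

theorem monomial_mem_algDual_iff (P : Fin m → (Fin s → K)) (mo : MonomialOrder (Fin s))
    (L : Submodule K (MvPolynomial (Fin s) K)) (a : Fin s →₀ ℕ) :
    monomial a (1 : K) ∈ algDual P mo L ↔ a ∈ stdMon mo (_root_.vanishingIdeal P) ∧
      monomial a (1 : K) ∈ colonKer (sumEval P) L := by
  simp [algDual, stdSpan_eq_restrictSupport, monomial_mem_restrictSupport, and_comm]

/-- Criterion: the dual of an evaluation code is a standard monomial code iff the number of
standard monomials in `(ker φ : L)` equals `|X| - dim L_X`. -/
theorem monomial_dual_criterion [Fintype K]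
    (P : Fin m → (Fin s → K)) (hP : Function.Injective P) (hm : 2 ≤ m)
    (mo : MonomialOrder (Fin s))
    (L : Submodule K (MvPolynomial (Fin s) K)) (hL : Module.Finite K L) :
    (∃ Γ : Set (Fin s →₀ ℕ),
        algDual P mo L = Submodule.span K ((fun a => monomial a (1 : K)) '' Γ)) ↔
      {a : Fin s →₀ ℕ | a ∈ stdMon mo (vanishingIdeal P) ∧
          monomial a (1 : K) ∈ colonKer (sumEval P) L}.ncard =
        m - Module.finrank K (Submodule.map (evalMap P) L) := by
  simp_rw [← monomial_mem_algDual_iff, ← finrank_algDual hP mo L]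
  have := finite_algDual hP mo L
  rw [← finrank_restrictSupport (K := K)]
  simp_rw [← restrictSupport_eq_span]
  have hle : restrictSupport K {a | monomial a (1 : K) ∈ algDual P mo L} ≤ algDual P mo L := by
    rw [restrictSupport_eq_span, Submodule.span_le]
    rintro _ ⟨a, ha, rfl⟩
    exact ha
  constructor
  · rintro ⟨Γ, hΓ⟩
    have hT : {a | monomial a (1 : K) ∈ algDual P mo L} = Γ := by
      ext a
      change monomial a (1 : K) ∈ algDual P mo L ↔ a ∈ Γ
      simp [hΓ, monomial_mem_restrictSupport]
    rw [hT, hΓ]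
  · exact fun h => ⟨_, (Submodule.eq_of_le_of_finrank_eq hle h).symm⟩

end
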